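/- Conjugate regular subgroups induce isomorphic skew brace structures: let 𝒢₁ and 𝒢₂ be regular subgroups of Hol(G) that are conjugate in Hol(G), and for i = 1, 2 let ∘ᵢ be the operation on G defined by a ∘ᵢ b := χᵢ⁻¹(χᵢ(b)·χᵢ(a)), where χᵢ(g) is the unique element x ∈ 𝒢ᵢ with x • g = 1. Then there exists an automorphism β ∈ Aut(G) such that β(a ∘₁ b) = β(a) ∘₂ β(b) for all a, b ∈ G. -/

import Mathlib

/-- The holomorph of a group `G`: the semidirect product `G ⋊ Aut(G)`. -/
abbrev Hol (G : Type*) [Group G] :=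
  SemidirectProduct G (MulAut G) (MonoidHom.id (MulAut G))

/-- The natural action of `Hol G` on `G`: `(h, α) • g = h * α g`. -/
instance holMulAction (G : Type*) [Group G] : MulAction (Hol G) G where
  smul x g := x.left * x.right g
  one_smul g := by
    show (1 : Hol G).left * (1 : Hol G).right g = g
    simp
  mul_smul x y g := by
    show (x * y).left * (x * y).right g = x.left * x.right (y.left * y.right g)
    simp [SemidirectProduct.mul_left, SemidirectProduct.mul_right, mul_assoc]

theorem hol_smul_def {G : Type*} [Group G] (x : Hol G) (g : G) :
    x • g = x.left * x.right g := rfl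

/-- A subgroup of `Hol G` is regular if its natural action on `G` is transitive and free. -/
def IsRegularSubgroup {G : Type*} [Group G] (𝒢 : Subgroup (Hol G)) : Prop :=
  (∀ g g' : G, ∃ x ∈ 𝒢, x • g = g') ∧
  (∀ x ∈ 𝒢, ∀ g : G, x • g = g → x = 1)

/-- The conjugate subgroup `x⁻¹ K x`. -/
def conjSubgroup {H : Type*} [Group H] (x : H) (K : Subgroup H) : Subgroup H :=
  K.map (MulAut.conj x⁻¹).toMonoidHom

/-- Two elements of a regular subgroup agreeing at one point are equal. -/
theorem IsRegularSubgroup.eq_of_smul_eq {G : Type*} [Group G] {𝒢 : Subgroup (Hol G)}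
    (h : IsRegularSubgroup 𝒢) {x y : Hol G} (hx : x ∈ 𝒢) (hy : y ∈ 𝒢) {g : G}
    (hxy : x • g = y • g) : x = y := by
  have : y⁻¹ * x = 1 := h.2 _ (𝒢.mul_mem (𝒢.inv_mem hy) hx) g <| by
    rw [mul_smul, hxy, inv_smul_smul]
  exact (inv_mul_eq_one.mp this).symm

/-- An element of the holomorph fixing the identity acts as its automorphism part. -/
theorem hol_smul_eq_right_of_smul_one {G : Type*} [Group G] {x : Hol G}
    (hx : x • (1 : G) = 1) (g : G) : x • g = x.right g := by
  have hleft : x.left = 1 := by simpa [hol_smul_def] using hx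
  rw [hol_smul_def, hleft, one_mul]

/-- A conjugator of a regular subgroup can be chosen to fix the identity. -/
theorem IsRegularSubgroup.exists_conj_fixing_one {G : Type*} [Group G]
    {𝒢 : Subgroup (Hol G)} (h : IsRegularSubgroup 𝒢) (x : Hol G) :
    ∃ y : Hol G, y • (1 : G) = 1 ∧ ∀ z ∈ 𝒢, y * z * y⁻¹ ∈ conjSubgroup x 𝒢 := by
  obtain ⟨k, hk, hk1⟩ := h.1 1 (x • (1 : G))
  refine ⟨x⁻¹ * k, by rw [mul_smul, hk1, inv_smul_smul], fun z hz => ?_⟩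
  refine Subgroup.mem_map.mpr
    ⟨k * z * k⁻¹, 𝒢.mul_mem (𝒢.mul_mem hk hz) (𝒢.inv_mem hk), ?_⟩
  simp only [MulEquiv.toMonoidHom_eq_coe, MonoidHom.coe_coe, MulAut.conj_apply]
  group

/-- Conjugate regular subgroups of `Hol G` induce isomorphic skew brace structures:
some automorphism of `G` intertwines the two circle operations. -/
theorem conj_regular_isomorphic_braces (G : Type*) [Group G]
    (𝒢₁ 𝒢₂ : Subgroup (Hol G))
    (hreg₁ : IsRegularSubgroup 𝒢₁) (hreg₂ : IsRegularSubgroup 𝒢₂)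
    (hconj : ∃ x : Hol G, conjSubgroup x 𝒢₁ = 𝒢₂)
    (χ₁ χ₂ : G → Hol G)
    (hmem₁ : ∀ g : G, χ₁ g ∈ 𝒢₁) (hact₁ : ∀ g : G, χ₁ g • g = 1)
    (hmem₂ : ∀ g : G, χ₂ g ∈ 𝒢₂) (hact₂ : ∀ g : G, χ₂ g • g = 1)
    (op₁ op₂ : G → G → G)
    (hop₁ : ∀ a b : G, χ₁ (op₁ a b) = χ₁ b * χ₁ a)
    (hop₂ : ∀ a b : G, χ₂ (op₂ a b) = χ₂ b * χ₂ a) :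
    ∃ β : MulAut G, ∀ a b : G, β (op₁ a b) = op₂ (β a) (β b) := by
  obtain ⟨x, rfl⟩ := hconj
  obtain ⟨y, hy1, hy⟩ := hreg₁.exists_conj_fixing_one x
  have hχ (a : G) : χ₂ (y.right a) = y * χ₁ a * y⁻¹ := by
    refine hreg₂.eq_of_smul_eq (hmem₂ _) (hy _ (hmem₁ a)) (g := y.right a) ?_
    rw [hact₂, ← hol_smul_eq_right_of_smul_one hy1, mul_smul, inv_smul_smul, mul_smul,
      hact₁, hy1]
  have hinj : Function.Injective χ₂ := fun a b hab =>
    MulAction.injective (χ₂ a) <| by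
      change χ₂ a • a = χ₂ a • b
      rw [hact₂, hab, hact₂]
  refine ⟨y.right, fun a b => hinj ?_⟩
  rw [hχ, hop₁, hop₂, hχ, hχ]
  group
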